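/- arXiv:1512.01612 — 2 statements merged into one kernel-verified Lean document; each statement's English description precedes it below -/
import Mathlib

section
/- Let n ≥ 2, k ∈ {1,…,n−1}, and let μ, ν ∈ S_n be a pair with ν = μ∘(k, k+1) and α := μ(k) < μ(k+1) =: β. Fix Y ∈ ℤ^n, integers x_1,…,x_{k−1}, x_{k+2},…,x_n, and x ∈ ℤ; for a,b ∈ ℤ write X(a,b) = (x_1,…,x_{k−1}, a, b, x_{k+2},…,x_n). Then for every t ≥ 0: b_{x−1} Σ_{σ∈{μ,ν}} Λ_Y(X(x−1,x);t;σ) = q b_{x−1} Σ_{σ∈{μ,ν}} Λ_Y(X(x,x−1);t;σ) + (1−q) b_x Σ_{σ∈{μ,ν}} Λ_Y(X(x,x);t;σ). -/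
/-- Extended product `∏'_{k=m}^{n} f k`. -/
noncomputable def eprod (f : ℤ → ℂ) (m n : ℤ) : ℂ :=
  if m ≤ n + 1 then ∏ k ∈ Finset.Icc m n, f k
  else ∏ k ∈ Finset.Icc (n + 1) (m - 1), (f k)⁻¹

/-- `A_σ(w_1,…,w_n)`: product of `S_{(β,α)}` over inversions `(β,α)` of `σ`. -/
noncomputable def Acoef (q : ℝ) {n : ℕ} (σ : Equiv.Perm (Fin n)) (w : Fin n → ℂ) : ℂ :=
  ∏ p ∈ Finset.univ.filter
      (fun p : Fin n × Fin n => p.2 < p.1 ∧ σ⁻¹ p.1 < σ⁻¹ p.2),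
    (-((q : ℂ) * w p.1 - w p.2) / ((q : ℂ) * w p.2 - w p.1))

/-- `B(w_1,…,w_n) = ∏_{i<j} (w_i - w_j)/(w_i - q w_j)`. -/
noncomputable def Bcoef (q : ℝ) {n : ℕ} (w : Fin n → ℂ) : ℂ :=
  ∏ p ∈ Finset.univ.filter (fun p : Fin n × Fin n => p.1 < p.2),
    (w p.1 - w p.2) / (w p.1 - (q : ℂ) * w p.2)

/-- Iterated contour integral over `n` counterclockwise circles of radius `R` centred at `0`,
outermost variable first. -/
noncomputable def mcInt : (n : ℕ) → ℝ → ((Fin n → ℂ) → ℂ) → ℂ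
  | 0, _, f => f (fun i => i.elim0)
  | n + 1, R, f => ∮ z in C(0, R), mcInt n R (fun w => f (Fin.cons z w))

/-- `Λ_Y(X;t;σ)`, with all contours the counterclockwise circle of radius `R`. -/
noncomputable def Lam (q : ℝ) (b : ℤ → ℝ) {n : ℕ} (Y X : Fin n → ℤ)
    (t : ℝ) (σ : Equiv.Perm (Fin n)) (R : ℝ) : ℂ :=
  (∏ k, (-1 : ℂ) / (b (X k) : ℂ)) * (1 / (2 * Real.pi * Complex.I)) ^ n *
    mcInt n R (fun w =>
      Acoef q σ w *
        ∏ j, (eprod (fun k => (b k : ℂ) / ((b k : ℂ) - w (σ j))) (Y (σ j)) (X j) *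
          Complex.exp (-(w j) * (t : ℂ))))

/-- `R` is a valid contour radius for `Λ_Y(X;·;·)`: `R > b k` for every integer `k` in
`[min_j min(x_j, y_j) - 1, max_j max(x_j, y_j)]`. -/
def ValidR (b : ℤ → ℝ) {n : ℕ} (X Y : Fin n → ℤ) (R : ℝ) : Prop :=
  ∀ k : ℤ, (∃ j, min (X j) (Y j) - 1 ≤ k) → (∃ j, k ≤ max (X j) (Y j)) → b k < R

/-- Number of coordinates of `X` equal to `s`. -/
def cnt {n : ℕ} (X : Fin n → ℤ) (s : ℤ) : ℕ :=
  (Finset.univ.filter (fun j => X j = s)).card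

/-- The `q`-deformed factorial `[k]_q! = ∏_{j=1}^{k} (1-q^j)/(1-q)`. -/
noncomputable def qfac (q : ℝ) (k : ℕ) : ℝ :=
  ∏ j ∈ Finset.Icc 1 k, (1 - q ^ j) / (1 - q)

/-- `W(X) = ∏_i [k_i]_q!` over the distinct values of `X` with multiplicities `k_i`. -/
noncomputable def Wcoef (q : ℝ) {n : ℕ} (X : Fin n → ℤ) : ℝ :=
  ∏ s ∈ Finset.univ.image X, qfac q (cnt X s)

/-- For `X` weakly decreasing, `lowerLast X s = X^{K,-}` where the coordinate lowered by `1`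
is the last one equal to `s`. -/
def lowerLast {n : ℕ} (X : Fin n → ℤ) (s : ℤ) : Fin n → ℤ :=
  fun j => if X j = s ∧ ∀ i, j < i → X i ≠ s then X j - 1 else X j

/-- The `q`-TAZRP master equation for a family `P(X;·)`, `X ∈ 𝕎^n`. -/
def MasterEq (q : ℝ) (a : ℤ → ℝ) {n : ℕ} (P : (Fin n → ℤ) → ℝ → ℂ) : Prop :=
  ∀ X : Fin n → ℤ, Antitone X → ∀ t : ℝ, 0 ≤ t →
    HasDerivAt (P X)
      ((∑ s ∈ Finset.univ.image X,
          (1 - (q : ℂ) ^ cnt (lowerLast X s) (s - 1)) * (a (s - 1) : ℂ) * P (lowerLast X s) t) -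
        ∑ s ∈ Finset.univ.image X,
          (1 - (q : ℂ) ^ cnt X s) * (a s : ℂ) * P X t) t

/-- The tuple `X` with coordinates `k` and `k+1` (0-based) replaced by `u` and `v`. -/
def set2 {n : ℕ} (X : Fin n → ℤ) (k : ℕ) (h : k + 1 < n) (u v : ℤ) : Fin n → ℤ :=
  Function.update (Function.update X ⟨k, by omega⟩ u) ⟨k + 1, h⟩ v

/-- The free particle evolution equation. -/
def FreeEvol (b : ℤ → ℝ) {n : ℕ} (u : (Fin n → ℤ) → ℝ → ℂ) : Prop :=
  ∀ X : Fin n → ℤ, ∀ t : ℝ, 0 ≤ t →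
    HasDerivAt (u X)
      (∑ k, ((b (X k - 1) : ℂ) * u (Function.update X k (X k - 1)) t -
        (b (X k) : ℂ) * u X t)) t

/-- The boundary conditions. -/
def BoundaryCond (q : ℝ) (b : ℤ → ℝ) {n : ℕ} (u : (Fin n → ℤ) → ℝ → ℂ) : Prop :=
  ∀ (k : ℕ) (h : k + 1 < n) (X : Fin n → ℤ) (x : ℤ) (t : ℝ), 0 ≤ t →
    (b (x - 1) : ℂ) * u (set2 X k h (x - 1) x) t =
      (q : ℂ) * (b (x - 1) : ℂ) * u (set2 X k h x (x - 1)) t +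
        (1 - (q : ℂ)) * (b x : ℂ) * u (set2 X k h x x) t

/-- The explicit one-particle transition probability. -/
noncomputable def P1 (b : ℤ → ℝ) (y x : ℤ) (t : ℝ) : ℝ :=
  if x < y then 0
  else if x = y then Real.exp (-(b y) * t)
  else (∏ k ∈ Finset.Icc y (x - 1), b k) *
    ∑ k ∈ Finset.Icc y x,
      (∏ j ∈ (Finset.Icc y x).erase k, (b j - b k)⁻¹) * Real.exp (-(b k) * t)

/-- The point of the torus `|w_j| = |R|` with the given angles. -/
noncomputable def torusPoint {n : ℕ} (R : ℝ) (θ : Fin n → ℝ) : Fin n → ℂ :=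
  fun i => circleMap 0 R (θ i)

lemma norm_torusPoint {n : ℕ} {R : ℝ} (hR : 0 < R) (θ : Fin n → ℝ) (i : Fin n) :
    ‖torusPoint R θ i‖ = R := by
  simp [torusPoint, abs_of_pos hR]

lemma continuous_torusPoint_apply {n : ℕ} (R : ℝ) (i : Fin n) :
    Continuous fun θ : Fin n → ℝ => torusPoint R θ i :=
  (continuous_circleMap 0 R).comp (continuous_apply i)

lemma cons_torusPoint {n : ℕ} (R φ : ℝ) (θ : Fin n → ℝ) :
    (Fin.cons (circleMap 0 R φ) (torusPoint R θ) : Fin (n + 1) → ℂ) =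
      torusPoint R (Fin.cons φ θ : Fin (n + 1) → ℝ) := by
  funext i
  refine Fin.cases ?_ (fun j => ?_) i <;> simp [torusPoint]

lemma continuous_mcInt {n : ℕ} (R : ℝ) {P : Type} [TopologicalSpace P]
    (F : P → (Fin n → ℂ) → ℂ)
    (hF : Continuous fun p : P × (Fin n → ℝ) => F p.1 (torusPoint R p.2)) :
    Continuous fun p => mcInt n R (F p) := by
  induction n generalizing P with
  | zero =>
    have h := hF.comp (Continuous.prodMk_left (X := P) (fun i : Fin 0 => i.elim0))
    convert h using 2 with p
    simp only [mcInt, Function.comp]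
    congr 1
    exact Subsingleton.elim _ _
  | succ n ih =>
    have h : Continuous fun p : P × ℝ =>
        mcInt n R (fun w => F p.1 (Fin.cons (circleMap 0 R p.2) w)) := by
      apply ih (fun (p : P × ℝ) w => F p.1 (Fin.cons (circleMap 0 R p.2) w))
      simp only [cons_torusPoint]
      exact hF.comp ((continuous_fst.comp continuous_fst).prodMk
        (Continuous.finCons (continuous_snd.comp continuous_fst) continuous_snd))
    simp only [mcInt, circleIntegral]
    apply intervalIntegral.continuous_parametric_intervalIntegral_of_continuous'
    simp only [Function.uncurry_def, deriv_circleMap]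
    exact (((continuous_circleMap 0 R).comp continuous_snd).mul continuous_const).smul h

lemma continuous_mcInt_cons {n : ℕ} {R : ℝ} {f : (Fin (n + 1) → ℂ) → ℂ}
    (hf : Continuous fun θ => f (torusPoint R θ)) :
    Continuous fun φ : ℝ => mcInt n R (fun w => f (Fin.cons (circleMap 0 R φ) w)) := by
  apply continuous_mcInt R (fun (φ : ℝ) w => f (Fin.cons (circleMap 0 R φ) w))
  simp only [cons_torusPoint]
  exact hf.comp (Continuous.finCons continuous_fst continuous_snd)

lemma continuous_cons_torusPoint {n : ℕ} {R : ℝ} {f : (Fin (n + 1) → ℂ) → ℂ}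
    (hf : Continuous fun θ => f (torusPoint R θ)) (φ : ℝ) :
    Continuous fun θ => f (Fin.cons (circleMap 0 R φ) (torusPoint R θ)) := by
  simp only [cons_torusPoint]
  exact hf.comp (Continuous.finCons continuous_const continuous_id)

lemma mcInt_congr {n : ℕ} {R : ℝ} {f g : (Fin n → ℂ) → ℂ}
    (h : ∀ θ, f (torusPoint R θ) = g (torusPoint R θ)) : mcInt n R f = mcInt n R g := by
  induction n with
  | zero =>
    have := h (fun i => i.elim0)
    simp only [mcInt]
    convert this using 2
  | succ n ih =>
    simp only [mcInt, circleIntegral]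
    congr 1
    funext φ
    congr 1
    apply ih
    intro θ
    simp only [cons_torusPoint]
    exact h _

lemma mcInt_const_mul {n : ℕ} (R : ℝ) (c : ℂ) (f : (Fin n → ℂ) → ℂ) :
    mcInt n R (fun w => c * f w) = c * mcInt n R f := by
  induction n with
  | zero => rfl
  | succ n ih => simp only [mcInt, ih, circleIntegral.integral_const_mul]

lemma mcInt_add {n : ℕ} {R : ℝ} {f g : (Fin n → ℂ) → ℂ}
    (hf : Continuous fun θ => f (torusPoint R θ))
    (hg : Continuous fun θ => g (torusPoint R θ)) :
    mcInt n R (fun w => f w + g w) = mcInt n R f + mcInt n R g := by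
  induction n with
  | zero => rfl
  | succ n ih =>
    have h : ∀ φ : ℝ, mcInt n R (fun w => f (Fin.cons (circleMap 0 R φ) w) +
        g (Fin.cons (circleMap 0 R φ) w)) =
        mcInt n R (fun w => f (Fin.cons (circleMap 0 R φ) w)) +
        mcInt n R (fun w => g (Fin.cons (circleMap 0 R φ) w)) := fun φ =>
      ih (continuous_cons_torusPoint hf φ) (continuous_cons_torusPoint hg φ)
    simp only [mcInt, circleIntegral, h, smul_add, deriv_circleMap]
    have hc : Continuous fun φ : ℝ => circleMap 0 R φ * Complex.I :=
      (continuous_circleMap 0 R).mul continuous_const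
    exact intervalIntegral.integral_add
      ((hc.smul (continuous_mcInt_cons hf)).intervalIntegrable _ _)
      ((hc.smul (continuous_mcInt_cons hg)).intervalIntegrable _ _)

lemma sub_ne_zero_of_lt_norm {r : ℝ} {w : ℂ} (hr : 0 < r) (h : r < ‖w‖) : (r : ℂ) - w ≠ 0 := by
  intro h0
  rw [← sub_eq_zero.mp h0, Complex.norm_real, Real.norm_of_nonneg hr.le] at h
  exact lt_irrefl _ h

lemma q_mul_sub_ne_zero {q R : ℝ} (hq : q ∈ Set.Ioo (0 : ℝ) 1) (hR : 0 < R) {z w : ℂ}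
    (hz : ‖z‖ = R) (hw : ‖w‖ = R) : (q : ℂ) * z - w ≠ 0 := by
  intro h0
  have h := congrArg norm (sub_eq_zero.mp h0)
  rw [norm_mul, hz, hw, Complex.norm_real, Real.norm_of_nonneg hq.1.le] at h
  nlinarith [hq.2]

lemma eprod_eq_pred_mul {f : ℤ → ℂ} {x : ℤ} (hf : f x ≠ 0) (y : ℤ) :
    eprod f y x = eprod f y (x - 1) * f x := by
  unfold eprod
  rcases lt_trichotomy y (x + 1) with h | h | h
  · rw [if_pos (by omega), if_pos (by omega),
      ← Finset.insert_Icc_sub_one_right_eq_Icc (by omega : y ≤ x),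
      Finset.prod_insert (by simp), mul_comm]
  · subst h
    simp [hf]
  · rw [if_neg (by omega), if_neg (by omega), sub_add_cancel,
      ← Finset.insert_Icc_add_one_left_eq_Icc (by omega : x ≤ y - 1),
      Finset.prod_insert (by simp)]
    field_simp

lemma continuous_eprod {P : Type*} [TopologicalSpace P] {f : ℤ → P → ℂ} {m n : ℤ}
    (hf : ∀ k, m ≤ k → k ≤ n → Continuous (f k))
    (hf' : ∀ k, n + 1 ≤ k → k ≤ m - 1 → Continuous (f k) ∧ ∀ p, f k p ≠ 0) :
    Continuous fun p => eprod (fun k => f k p) m n := by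
  unfold eprod
  split_ifs
  · exact continuous_finsetProd _ fun k hk =>
      hf k (Finset.mem_Icc.mp hk).1 (Finset.mem_Icc.mp hk).2
  · exact continuous_finsetProd _ fun k hk =>
      have h := hf' k (Finset.mem_Icc.mp hk).1 (Finset.mem_Icc.mp hk).2
      h.1.inv₀ h.2

lemma continuous_Acoef {q R : ℝ} (hq : q ∈ Set.Ioo (0 : ℝ) 1) (hR : 0 < R) {n : ℕ}
    (σ : Equiv.Perm (Fin n)) : Continuous fun θ => Acoef q σ (torusPoint R θ) := by
  unfold Acoef
  refine continuous_finsetProd _ fun p _ => ?_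
  have h := continuous_torusPoint_apply (n := n) R
  exact ((continuous_const.mul (h _)).sub (h _)).neg.div
    ((continuous_const.mul (h _)).sub (h _))
    fun θ => q_mul_sub_ne_zero hq hR (norm_torusPoint hR θ _) (norm_torusPoint hR θ _)

/-- The integrand of `Lam`. -/
noncomputable def lamIntegrand (q : ℝ) (b : ℤ → ℝ) {n : ℕ} (Y X : Fin n → ℤ)
    (t : ℝ) (σ : Equiv.Perm (Fin n)) (w : Fin n → ℂ) : ℂ :=
  Acoef q σ w *
    ∏ j, (eprod (fun k => (b k : ℂ) / ((b k : ℂ) - w (σ j))) (Y (σ j)) (X j) *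
      Complex.exp (-(w j) * (t : ℂ)))

lemma continuous_lamIntegrand {q R : ℝ} (hq : q ∈ Set.Ioo (0 : ℝ) 1) (hR : 0 < R)
    {b : ℤ → ℝ} (hb : ∀ i, 0 < b i) {n : ℕ} {Y X : Fin n → ℤ} (hV : ValidR b X Y R)
    (t : ℝ) (σ : Equiv.Perm (Fin n)) :
    Continuous fun θ => lamIntegrand q b Y X t σ (torusPoint R θ) := by
  have hw := continuous_torusPoint_apply (n := n) R
  refine (continuous_Acoef hq hR σ).mul (continuous_finsetProd _ fun j _ => ?_)
  have hne : ∀ k, b k < R → ∀ θ : Fin n → ℝ, (b k : ℂ) - torusPoint R θ (σ j) ≠ 0 :=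
    fun k hk θ => sub_ne_zero_of_lt_norm (hb k) (by rwa [norm_torusPoint hR])
  have hcont : ∀ k, b k < R → Continuous fun θ : Fin n → ℝ =>
      (b k : ℂ) / ((b k : ℂ) - torusPoint R θ (σ j)) := fun k hk =>
    continuous_const.div (continuous_const.sub (hw _)) (hne k hk)
  refine Continuous.mul ?_ (Complex.continuous_exp.comp ((hw j).neg.mul continuous_const))
  refine continuous_eprod
    (f := fun k (θ : Fin n → ℝ) => (b k : ℂ) / ((b k : ℂ) - torusPoint R θ (σ j))) ?_ ?_
  · intro k h1 h2
    exact hcont k (hV k ⟨σ j, by omega⟩ ⟨j, by omega⟩)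
  · intro k h1 h2
    have hk : b k < R := hV k ⟨j, by omega⟩ ⟨σ j, by omega⟩
    exact ⟨hcont k hk, fun θ =>
      div_ne_zero (Complex.ofReal_ne_zero.mpr (hb k).ne') (hne k hk θ)⟩

lemma prod_set2 {n : ℕ} (F : Fin n → ℤ → ℂ) (X : Fin n → ℤ) (k : ℕ) (h : k + 1 < n) (u v : ℤ) :
    ∏ j, F j (set2 X k h u v j) =
      (∏ j ∈ (Finset.univ.erase ⟨k, by omega⟩).erase ⟨k + 1, h⟩, F j (X j)) *
        (F ⟨k, by omega⟩ u * F ⟨k + 1, h⟩ v) := by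
  have hne : (⟨k + 1, h⟩ : Fin n) ≠ ⟨k, by omega⟩ := by simp
  rw [← Finset.mul_prod_erase _ _ (Finset.mem_univ (⟨k, by omega⟩ : Fin n)),
    ← Finset.mul_prod_erase _ _
      (Finset.mem_erase.mpr ⟨hne, Finset.mem_univ (⟨k + 1, h⟩ : Fin n)⟩)]
  have hrest : ∏ j ∈ (Finset.univ.erase ⟨k, by omega⟩).erase ⟨k + 1, h⟩,
      F j (set2 X k h u v j) =
      ∏ j ∈ (Finset.univ.erase ⟨k, by omega⟩).erase ⟨k + 1, h⟩, F j (X j) := by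
    refine Finset.prod_congr rfl fun j hj => ?_
    simp only [Finset.mem_erase] at hj
    simp [set2, Function.update_of_ne hj.1, Function.update_of_ne hj.2.1]
  rw [hrest]
  simp only [set2, Function.update_self, Function.update_of_ne hne.symm]
  ring

lemma Acoef_mul_swap (q : ℝ) {n : ℕ} (k : ℕ) (h : k + 1 < n) (μ : Equiv.Perm (Fin n))
    (hμ : μ ⟨k, by omega⟩ < μ ⟨k + 1, h⟩) (w : Fin n → ℂ) :
    Acoef q (μ * Equiv.swap ⟨k, by omega⟩ ⟨k + 1, h⟩) w =
      -((q : ℂ) * w (μ ⟨k + 1, h⟩) - w (μ ⟨k, by omega⟩)) /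
        ((q : ℂ) * w (μ ⟨k, by omega⟩) - w (μ ⟨k + 1, h⟩)) * Acoef q μ w := by
  set i : Fin n := ⟨k, by omega⟩ with hi
  set j : Fin n := ⟨k + 1, h⟩ with hj
  have hij : i < j := by simp [hi, hj]
  unfold Acoef
  have hset : Finset.univ.filter (fun p : Fin n × Fin n =>
        p.2 < p.1 ∧ (μ * Equiv.swap i j)⁻¹ p.1 < (μ * Equiv.swap i j)⁻¹ p.2) =
      insert (μ j, μ i) (Finset.univ.filter (fun p : Fin n × Fin n =>
        p.2 < p.1 ∧ μ⁻¹ p.1 < μ⁻¹ p.2)) := by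
    ext ⟨p, r⟩
    obtain ⟨p, rfl⟩ := μ.surjective p
    obtain ⟨r, rfl⟩ := μ.surjective r
    have hinv : ∀ a, μ⁻¹ (μ a) = a := μ.symm_apply_apply
    simp only [Finset.mem_filter, Finset.mem_univ, true_and, Finset.mem_insert, mul_inv_rev,
      Equiv.swap_inv, Equiv.Perm.coe_mul, Function.comp_apply, hinv,
      Prod.mk.injEq, EmbeddingLike.apply_eq_iff_eq]
    have hlt : ∀ a c : Fin n, ¬ (a = j ∧ c = i) → ¬ (a = i ∧ c = j) →
        (Equiv.swap i j a < Equiv.swap i j c ↔ a < c) := by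
      intro a c h1 h2
      simp only [Equiv.swap_apply_def]
      simp only [Fin.ext_iff, Fin.lt_def, hi, hj] at *
      split_ifs <;> simp_all <;> omega
    by_cases h1 : p = j ∧ r = i
    · obtain ⟨rfl, rfl⟩ := h1
      simp [hμ, hij]
    · by_cases h2 : p = i ∧ r = j
      · obtain ⟨rfl, rfl⟩ := h2
        simp [hμ.le, hij.ne]
      · rw [hlt p r h1 h2]
        simp [h1]
  rw [hset, Finset.prod_insert (by simp [hij.le])]

lemma pair_kernel_relation {q b u v S : ℂ} (hu : b - u ≠ 0) (hv : b - v ≠ 0)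
    (hS : q * u - v ≠ 0) (hS' : S = -(q * v - u) / (q * u - v)) :
    1 / (b - v) + S * (1 / (b - u)) =
      q * (1 / (b - u) + S * (1 / (b - v))) +
        (1 - q) * (b * (1 / (b - u)) * (1 / (b - v)) * (1 + S)) := by
  subst hS'
  field_simp
  ring

/-- the pair `{μ, ν = μ∘(k,k+1)}` of permutations satisfies the two-particle
boundary relation. -/
theorem pair_boundary_relation
    (q : ℝ) (hq : q ∈ Set.Ioo (0 : ℝ) 1) (a b : ℤ → ℝ)
    (ha : ∀ i, 0 < a i) (hb : ∀ i, b i = a i * (1 - q))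
    (n : ℕ) (k : ℕ) (hk : k + 1 < n + 2)
    (μ ν : Equiv.Perm (Fin (n + 2)))
    (hν : ν = μ * Equiv.swap ⟨k, by omega⟩ ⟨k + 1, hk⟩)
    (hαβ : μ ⟨k, by omega⟩ < μ ⟨k + 1, hk⟩)
    (Y Xb : Fin (n + 2) → ℤ) (x : ℤ) (t : ℝ) (ht : 0 ≤ t) (R : ℝ)
    (hR1 : ValidR b (set2 Xb k hk (x - 1) x) Y R)
    (hR2 : ValidR b (set2 Xb k hk x (x - 1)) Y R)
    (hR3 : ValidR b (set2 Xb k hk x x) Y R) :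
    (b (x - 1) : ℂ) *
        (Lam q b Y (set2 Xb k hk (x - 1) x) t μ R +
          Lam q b Y (set2 Xb k hk (x - 1) x) t ν R) =
      (q : ℂ) * (b (x - 1) : ℂ) *
          (Lam q b Y (set2 Xb k hk x (x - 1)) t μ R +
            Lam q b Y (set2 Xb k hk x (x - 1)) t ν R) +
        (1 - (q : ℂ)) * (b x : ℂ) *
          (Lam q b Y (set2 Xb k hk x x) t μ R +
            Lam q b Y (set2 Xb k hk x x) t ν R) := by
  have hq1 : 0 < 1 - q := by linarith [hq.2]
  have hbpos : ∀ i, 0 < b i := fun i => by rw [hb]; exact mul_pos (ha i) hq1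
  have hbx : b x < R := by
    refine hR3 x ⟨⟨k, by omega⟩, ?_⟩ ⟨⟨k + 1, hk⟩, ?_⟩ <;> simp [set2]
  have hR : 0 < R := (hbpos x).trans hbx
  have hB : ∀ i, (b i : ℂ) ≠ 0 := fun i => Complex.ofReal_ne_zero.mpr (hbpos i).ne'
  set i : Fin (n + 2) := ⟨k, by omega⟩ with hi
  set j : Fin (n + 2) := ⟨k + 1, hk⟩ with hj
  set X₁ := set2 Xb k hk (x - 1) x with hX₁
  set X₂ := set2 Xb k hk x (x - 1) with hX₂
  set X₃ := set2 Xb k hk x x with hX₃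
  set D : ℂ := ∏ l ∈ (Finset.univ.erase i).erase j, (-1 : ℂ) / (b (Xb l) : ℂ)
  have hpre : ∀ u v : ℤ, ∏ l, (-1 : ℂ) / (b (set2 Xb k hk u v l) : ℂ) =
      D * ((-1 : ℂ) / b u * ((-1 : ℂ) / b v)) := fun u v =>
    prod_set2 (fun _ z => (-1 : ℂ) / (b z : ℂ)) Xb k hk u v
  have hLam : ∀ (X : Fin (n + 2) → ℤ) σ, Lam q b Y X t σ R =
      (∏ l, (-1 : ℂ) / (b (X l) : ℂ)) * (1 / (2 * Real.pi * Complex.I)) ^ (n + 2) *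
        mcInt (n + 2) R (lamIntegrand q b Y X t σ) := fun X σ => rfl
  have hsum : ∀ X : Fin (n + 2) → ℤ, ValidR b X Y R →
      mcInt (n + 2) R (lamIntegrand q b Y X t μ) + mcInt (n + 2) R (lamIntegrand q b Y X t ν) =
      mcInt (n + 2) R (fun w => lamIntegrand q b Y X t μ w + lamIntegrand q b Y X t ν w) :=
    fun X hX => (mcInt_add (continuous_lamIntegrand hq hR hbpos hX t μ)
      (continuous_lamIntegrand hq hR hbpos hX t ν)).symm
  have hcont : ∀ X : Fin (n + 2) → ℤ, ValidR b X Y R → Continuous fun θ =>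
      lamIntegrand q b Y X t μ (torusPoint R θ) + lamIntegrand q b Y X t ν (torusPoint R θ) :=
    fun X hX => (continuous_lamIntegrand hq hR hbpos hX t μ).add
      (continuous_lamIntegrand hq hR hbpos hX t ν)
  have hint : mcInt (n + 2) R
        (fun w => lamIntegrand q b Y X₁ t μ w + lamIntegrand q b Y X₁ t ν w) =
      q * mcInt (n + 2) R
        (fun w => lamIntegrand q b Y X₂ t μ w + lamIntegrand q b Y X₂ t ν w) +
      (1 - q) * mcInt (n + 2) R
        (fun w => lamIntegrand q b Y X₃ t μ w + lamIntegrand q b Y X₃ t ν w) := by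
    rw [← mcInt_const_mul, ← mcInt_const_mul, ← mcInt_add
      (continuous_const.mul (hcont X₂ hR2)) (continuous_const.mul (hcont X₃ hR3))]
    refine mcInt_congr fun θ => ?_
    set w := torusPoint R θ
    have hwn : ∀ l, ‖w l‖ = R := norm_torusPoint hR θ
    have hsub : ∀ l, (b x : ℂ) - w l ≠ 0 := fun l =>
      sub_ne_zero_of_lt_norm (hbpos x) (by rwa [hwn])
    set E : Fin (n + 2) → ℤ → ℂ := fun l z =>
      eprod (fun k => (b k : ℂ) / ((b k : ℂ) - w l)) (Y l) z
    have hstep : ∀ l, E l x = E l (x - 1) * (b x / (b x - w l)) := fun l =>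
      eprod_eq_pred_mul (f := fun k => (b k : ℂ) / ((b k : ℂ) - w l))
        (div_ne_zero (hB x) (hsub l)) (Y l)
    set C : ℂ := ∏ l ∈ (Finset.univ.erase i).erase j, E (μ l) (Xb l)
    have hμ : ∀ u v, lamIntegrand q b Y (set2 Xb k hk u v) t μ w =
        Acoef q μ w * (C * (E (μ i) u * E (μ j) v) *
          ∏ l, Complex.exp (-(w l) * (t : ℂ))) := fun u v => by
      unfold lamIntegrand
      rw [Finset.prod_mul_distrib, prod_set2 (fun l z => E (μ l) z) Xb k hk u v]
    have hνv : ∀ u v, lamIntegrand q b Y (set2 Xb k hk u v) t ν w =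
        Acoef q ν w * (C * (E (μ j) u * E (μ i) v) *
          ∏ l, Complex.exp (-(w l) * (t : ℂ))) := fun u v => by
      unfold lamIntegrand
      rw [Finset.prod_mul_distrib, prod_set2 (fun l z => E (ν l) z) Xb k hk u v]
      have h1 : ν i = μ j := by simp [hν]
      have h2 : ν j = μ i := by simp [hν]
      rw [← hi, ← hj, h1, h2]
      have h3 : ∏ l ∈ (Finset.univ.erase i).erase j, E (ν l) (Xb l) = C := by
        refine Finset.prod_congr rfl fun l hl => ?_
        simp only [Finset.mem_erase] at hl
        rw [hν, Equiv.Perm.mul_apply, Equiv.swap_apply_of_ne_of_ne hl.2.1 hl.1]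
      rw [h3]
    have hA := Acoef_mul_swap q k hk μ hαβ w
    rw [← hi, ← hj, ← hν] at hA
    have hker := pair_kernel_relation (hsub (μ i)) (hsub (μ j))
      (q_mul_sub_ne_zero hq hR (hwn (μ i)) (hwn (μ j))) rfl
    rw [hX₁, hX₂, hX₃]
    simp only [hμ, hνv, hstep, hA]
    linear_combination (Acoef q μ w * C * (∏ l, Complex.exp (-(w l) * (t : ℂ))) *
      E (μ i) (x - 1) * E (μ j) (x - 1) * b x) * hker
  simp only [hLam, ← mul_add, hsum X₁ hR1, hsum X₂ hR2, hsum X₃ hR3, hint]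
  rw [hX₁, hX₂, hX₃]
  simp only [hpre]
  have h1 := hB x
  have h2 := hB (x - 1)
  field_simp
end

section
/- Let n ≥ 1, X, Y ∈ 𝕎^n, k ∈ {1,…,n}, and σ ∈ S_n with σ(1) = k. If x_1 > y_k, then Λ_Y(X;0;σ) = 0. -/
open MeasureTheory Set Filter Topology

/-- The distinguished boundary of the polydisc of radius `R` centred at `0`. -/
def torusSet (n : ℕ) (R : ℝ) : Set (Fin n → ℂ) := {w | ∀ i, ‖w i‖ = R}

lemma torusMap_mem_torusSet {n : ℕ} {R : ℝ} (hR : 0 ≤ R) (θ : Fin n → ℝ) :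
    torusMap 0 (fun _ => R) θ ∈ torusSet n R := by
  intro i
  simp [torusMap, Complex.norm_exp_ofReal_mul_I, abs_of_nonneg hR]

lemma torusIntegrable_of_continuousOn {n : ℕ} {R : ℝ} (hR : 0 ≤ R) {f : (Fin n → ℂ) → ℂ}
    (hf : ContinuousOn f (torusSet n R)) : TorusIntegrable f 0 (fun _ => R) := by
  have hc : Continuous fun θ : Fin n → ℝ => f (torusMap 0 (fun _ => R) θ) := by
    refine hf.comp_continuous ?_ (torusMap_mem_torusSet hR)
    unfold torusMap
    fun_prop
  exact hc.continuousOn.integrableOn_compact isCompact_Icc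

lemma mcInt_eq_torusIntegral {n : ℕ} {R : ℝ} (hR : 0 ≤ R) {f : (Fin n → ℂ) → ℂ}
    (hf : ContinuousOn f (torusSet n R)) : mcInt n R f = torusIntegral f 0 (fun _ => R) := by
  induction n with
  | zero =>
    rw [torusIntegral_dim0, mcInt]
    congr 1
    exact Subsingleton.elim _ _
  | succ n ih =>
    rw [torusIntegral_succ (torusIntegrable_of_continuousOn hR hf), mcInt]
    refine circleIntegral.integral_congr hR fun z hz => ?_
    refine ih (hf.comp (by fun_prop) fun w hw => ?_)
    intro i
    refine Fin.cases ?_ (fun j => ?_) i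
    · simpa using hz
    · simpa using hw j

/-- Fubini: an integral over a torus vanishes as soon as all its integrals in one of the
variables do. -/
lemma torusIntegral_eq_zero_of_circleIntegral_update {n : ℕ} {R : ℝ} (hR : 0 ≤ R)
    {f : (Fin (n + 1) → ℂ) → ℂ} (hf : ContinuousOn f (torusSet (n + 1) R)) (k : Fin (n + 1))
    (h0 : ∀ w ∈ torusSet (n + 1) R, (∮ z in C(0, R), f (Function.update w k z)) = 0) :
    torusIntegral f 0 (fun _ => R) = 0 := by
  set e : ℝ × (Fin n → ℝ) ≃ᵐ (Fin (n + 1) → ℝ) :=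
    (MeasurableEquiv.piFinSuccAbove (fun _ => ℝ) k).symm
  have hem : MeasurePreserving e :=
    (volume_preserving_piFinSuccAbove (fun _ : Fin (n + 1) => ℝ) k).symm _
  have heπ : (e ⁻¹' Icc 0 fun _ => 2 * Real.pi) =
      Icc 0 (2 * Real.pi) ×ˢ Icc (0 : Fin n → ℝ) fun _ => 2 * Real.pi :=
    ((Fin.insertNthOrderIso (fun _ => ℝ) k).preimage_Icc _ _).trans (Icc_prod_eq _ _)
  have hint := (torusIntegrable_of_continuousOn hR hf).function_integrable
  rw [← hem.integrableOn_comp_preimage e.measurableEmbedding, heπ, IntegrableOn,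
    Measure.volume_eq_prod, ← Measure.prod_restrict] at hint
  rw [torusIntegral, ← hem.map_eq, setIntegral_map_equiv, heπ, Measure.volume_eq_prod,
    ← Measure.prod_restrict]
  refine (integral_prod_symm _ hint).trans ?_
  refine integral_eq_zero_of_ae (Eventually.of_forall fun Θ => ?_)
  set w : Fin (n + 1) → ℂ := torusMap 0 (fun _ => R) (k.insertNth 0 Θ) with hw
  have key := h0 w (torusMap_mem_torusSet hR _)
  rw [circleIntegral_def_Icc] at key
  have : ∀ θ : ℝ, torusMap 0 (fun _ => R) (e (θ, Θ)) = Function.update w k (circleMap 0 R θ) := by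
    intro θ
    ext i
    rcases k.eq_self_or_eq_succAbove i with rfl | ⟨j, rfl⟩
    · simp [e, torusMap, circleMap, Fin.insertNthEquiv]
    · simp [e, hw, torusMap, Fin.insertNthEquiv, Fin.succAbove_ne]
  simp only [Function.comp_apply, this, Pi.zero_apply]
  refine Eq.trans ?_ ((congrArg
    ((∏ i : Fin n, (R : ℂ) * Complex.exp (Θ i * Complex.I) * Complex.I) * ·) key).trans
    (mul_zero _))
  simp only [← integral_const_mul]
  refine integral_congr_ae (Eventually.of_forall fun θ => ?_)
  simp only [smul_eq_mul, deriv_circleMap, circleMap_zero, k.prod_univ_succAbove]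
  simp [e, Fin.insertNthEquiv]
  ring

/-- A function holomorphic outside a disc and `o(1/z)` at infinity has vanishing integral over
the boundary circle. -/
lemma circleIntegral_eq_zero_of_tendsto_mul {R : ℝ} (hR : 0 < R) {g : ℂ → ℂ}
    (hd : ∀ z, R ≤ ‖z‖ → DifferentiableAt ℂ g z)
    (hg : Tendsto (fun z => z * g z) (Bornology.cobounded ℂ) (𝓝 0)) :
    (∮ z in C(0, R), g z) = 0 := by
  rw [← norm_le_zero_iff]
  refine le_of_forall_pos_le_add fun ε hε => ?_
  rw [zero_add]
  have h1 := (Metric.tendsto_nhds.1 hg) (ε / (2 * Real.pi)) (by positivity)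
  rw [← comap_norm_atTop, eventually_comap] at h1
  obtain ⟨r, hr, hRr⟩ := (h1.and (eventually_ge_atTop R)).exists
  have hr0 : 0 < r := hR.trans_le hRr
  have hEq : (∮ z in C(0, r), g z) = ∮ z in C(0, R), g z := by
    refine Complex.circleIntegral_eq_of_differentiable_on_annulus_off_countable hR hRr
      countable_empty (fun z hz => ?_) (fun z hz => hd z ?_)
    · refine (hd z ?_).continuousAt.continuousWithinAt
      simpa using hz.2
    · have := hz.1.2
      simp at this
      exact this.le
  rw [← hEq]
  refine (circleIntegral.norm_integral_le_of_norm_le_const hr0.le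
    (C := ε / (2 * Real.pi) / r) fun z hz => ?_).trans_eq ?_
  · have hz' : ‖z‖ = r := by simpa using hz
    have := hr z hz'
    rw [dist_zero_right, norm_mul, hz'] at this
    rw [le_div_iff₀ hr0]
    linarith
  · field_simp

lemma tendsto_const_sub_inv_cobounded (c : ℂ) :
    Tendsto (fun z : ℂ => (c - z)⁻¹) (Bornology.cobounded ℂ) (𝓝 0) := by
  refine tendsto_inv₀_cobounded.comp ?_
  exact tendsto_const_sub_cobounded c

lemma tendsto_mul_const_sub_inv_cobounded (c : ℂ) :
    Tendsto (fun z : ℂ => z * (c - z)⁻¹) (Bornology.cobounded ℂ) (𝓝 (-1)) := by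
  have h := ((tendsto_const_sub_inv_cobounded c).const_mul c).sub_const 1
  rw [mul_zero, zero_sub] at h
  refine h.congr' ?_
  filter_upwards [Bornology.isBounded_def.1 (Bornology.isBounded_singleton (x := c))] with z hz
  have : c - z ≠ 0 := sub_ne_zero.2 (Ne.symm hz)
  field_simp
  ring

/-- An extended product with at least two factors `c_k / (c_k - z)` is `o(1/z)` at infinity. -/
lemma tendsto_mul_eprod_cobounded (c : ℤ → ℂ) {m n : ℤ} (h : m < n) :
    Tendsto (fun z => z * eprod (fun k => c k / (c k - z)) m n) (Bornology.cobounded ℂ) (𝓝 0) := by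
  have h1 : Tendsto (fun z => ∏ k ∈ Finset.Ioc m n, c k / (c k - z)) (Bornology.cobounded ℂ)
      (𝓝 (∏ k ∈ Finset.Ioc m n, 0)) := by
    refine tendsto_finsetProd _ fun k _ => ?_
    simpa [div_eq_mul_inv] using (tendsto_const_sub_inv_cobounded (c k)).const_mul (c k)
  rw [Finset.prod_eq_zero (i := n) (by simp [h]) rfl] at h1
  have h2 := ((tendsto_mul_const_sub_inv_cobounded (c m)).const_mul (c m)).mul h1
  rw [mul_zero] at h2
  refine h2.congr fun z => ?_
  rw [eprod, if_pos (by omega), ← Finset.mul_prod_Ioc_eq_prod_Icc h.le]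
  ring

/-- The scattering factor with the larger index sent to infinity tends to `q`. -/
lemma tendsto_scattering_cobounded (q v : ℂ) :
    Tendsto (fun z : ℂ => -(q * z - v) / (q * v - z)) (Bornology.cobounded ℂ) (𝓝 q) := by
  have h := ((tendsto_mul_const_sub_inv_cobounded (q * v)).const_mul (-q)).add
    ((tendsto_const_sub_inv_cobounded (q * v)).const_mul v)
  rw [show -q * -1 + v * 0 = q by ring] at h
  refine h.congr fun z => ?_
  rw [div_eq_mul_inv]
  ring

lemma differentiableAt_finsetProd {E ι : Type*} [NormedAddCommGroup E] [NormedSpace ℂ E]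
    {s : Finset ι} {f : ι → E → ℂ} {x : E} (hf : ∀ i ∈ s, DifferentiableAt ℂ (f i) x) :
    DifferentiableAt ℂ (fun w => ∏ i ∈ s, f i w) x := by
  classical
  exact (HasFDerivAt.finsetProd fun i hi => (hf i hi).hasFDerivAt).differentiableAt

lemma differentiableAt_eprod {E : Type*} [NormedAddCommGroup E] [NormedSpace ℂ E] {b : ℤ → ℝ}
    (hb : ∀ i, 0 < b i) {R : ℝ} {m n : ℤ} (hR : ∀ i ∈ Finset.Icc m n, b i < R) {u : E → ℂ} {x : E}
    (hu : DifferentiableAt ℂ u x) (hx : R ≤ ‖u x‖) :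
    DifferentiableAt ℂ (fun w => eprod (fun k => (b k : ℂ) / ((b k : ℂ) - u w)) m n) x := by
  unfold eprod
  split_ifs with h
  · refine differentiableAt_finsetProd fun i hi => ?_
    have : (b i : ℂ) - u x ≠ 0 := by
      intro h0
      have := hR i hi
      rw [← sub_eq_zero.1 h0, Complex.norm_real, Real.norm_of_nonneg (hb i).le] at hx
      linarith
    fun_prop (disch := assumption)
  · refine differentiableAt_finsetProd fun i _ => ?_
    simp only [inv_div]
    fun_prop

lemma differentiableAt_Acoef {E : Type*} [NormedAddCommGroup E] [NormedSpace ℂ E] {q : ℝ} {n : ℕ}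
    {σ : Equiv.Perm (Fin n)} {u : E → Fin n → ℂ} {x : E} (hu : ∀ i, DifferentiableAt ℂ (u · i) x)
    (hx : ∀ i j, j < i → σ⁻¹ i < σ⁻¹ j → (q : ℂ) * u x j - u x i ≠ 0) :
    DifferentiableAt ℂ (fun w => Acoef q σ (u w)) x := by
  unfold Acoef
  refine differentiableAt_finsetProd fun p hp => ?_
  have hp' := (Finset.mem_filter.1 hp).2
  have h1 := hu p.1
  have h2 := hu p.2
  have := hx p.1 p.2 hp'.1 hp'.2
  fun_prop (disch := assumption)

lemma mul_sub_ne_zero_of_norm {q : ℝ} (hq : q ∈ Set.Ioo (0 : ℝ) 1) {R : ℝ} (hR : 0 < R) {u v : ℂ}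
    (hu : ‖u‖ = R) (hv : R ≤ ‖v‖) : (q : ℂ) * u - v ≠ 0 := by
  intro h
  rw [← sub_eq_zero.1 h, norm_mul, Complex.norm_real, Real.norm_of_nonneg hq.1.le, hu] at hv
  nlinarith [hq.2]

/-- `Λ_Y(X;0;σ) = 0` when `σ(1) = k` and `x_1 > y_k`. -/
theorem lam_vanishes_of_x1_gt_yk
    (q : ℝ) (hq : q ∈ Set.Ioo (0 : ℝ) 1) (a b : ℤ → ℝ)
    (ha : ∀ i, 0 < a i) (hb : ∀ i, b i = a i * (1 - q))
    (n : ℕ) (X Y : Fin (n + 1) → ℤ) (hX : Antitone X) (hY : Antitone Y)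
    (k : Fin (n + 1)) (σ : Equiv.Perm (Fin (n + 1))) (hσ : σ 0 = k)
    (h : Y k < X 0) (R : ℝ) (hR : ValidR b X Y R) :
    Lam q b Y X 0 σ R = 0 := by
  have hb0 : ∀ i, 0 < b i := fun i => by
    rw [hb]
    exact mul_pos (ha i) (sub_pos.2 hq.2)
  have hbR : ∀ j, ∀ i ∈ Finset.Icc (Y (σ j)) (X j), b i < R := fun j i hi => by
    obtain ⟨h1, h2⟩ := Finset.mem_Icc.1 hi
    exact hR i ⟨σ j, by omega⟩ ⟨j, by omega⟩
  have hR0 : 0 < R := (hb0 (X 0)).trans (hR _ ⟨0, by omega⟩ ⟨0, by omega⟩)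
  unfold Lam
  simp only [Complex.ofReal_zero, mul_zero, Complex.exp_zero, mul_one]
  refine mul_eq_zero_of_right _ ?_
  have hcont : ContinuousOn (fun w : Fin (n + 1) → ℂ => Acoef q σ w *
      ∏ j, eprod (fun k => (b k : ℂ) / ((b k : ℂ) - w (σ j))) (Y (σ j)) (X j))
      (torusSet (n + 1) R) := by
    intro w hw
    have hA : DifferentiableAt ℂ (fun w => Acoef q σ w) w :=
      differentiableAt_Acoef (fun i => by fun_prop) fun i j _ _ =>
        mul_sub_ne_zero_of_norm hq hR0 (hw j) (hw i).ge
    have hE : ∀ j ∈ Finset.univ, DifferentiableAt ℂ (fun w : Fin (n + 1) → ℂ =>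
        eprod (fun k => (b k : ℂ) / ((b k : ℂ) - w (σ j))) (Y (σ j)) (X j)) w := fun j _ =>
      differentiableAt_eprod hb0 (hbR j) (u := fun w : Fin (n + 1) → ℂ => w (σ j))
        (by fun_prop) (hw _).ge
    exact (hA.mul (differentiableAt_finsetProd hE)).continuousAt.continuousWithinAt
  rw [mcInt_eq_torusIntegral hR0.le hcont]
  refine torusIntegral_eq_zero_of_circleIntegral_update hR0.le hcont k fun w hw => ?_
  have hupd : ∀ i, ∀ z : ℂ, DifferentiableAt ℂ (fun z => Function.update w k z i) z := by
    intro i z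
    rcases eq_or_ne i k with rfl | hi
    · simp
    · simp [Function.update_of_ne hi]
  have hnorm : ∀ i, ∀ z : ℂ, R ≤ ‖z‖ → R ≤ ‖Function.update w k z i‖ := by
    intro i z hz
    rcases eq_or_ne i k with rfl | hi
    · simpa
    · simpa [Function.update_of_ne hi] using (hw i).ge
  have hinv : ∀ i j, σ⁻¹ i < σ⁻¹ j → j ≠ k := by
    rintro i j hij rfl
    rw [← hσ, Equiv.Perm.inv_def, Equiv.symm_apply_apply] at hij
    exact absurd hij (Fin.not_lt_zero _)
  refine circleIntegral_eq_zero_of_tendsto_mul hR0 (fun z hz => ?_) ?_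
  · refine DifferentiableAt.mul ?_ (differentiableAt_finsetProd fun j _ => ?_)
    · refine differentiableAt_Acoef (fun i => hupd i z) fun i j _ hij => ?_
      refine mul_sub_ne_zero_of_norm hq hR0 ?_ (hnorm i z hz)
      rw [Function.update_of_ne (hinv i j hij)]
      exact hw j
    · exact differentiableAt_eprod hb0 (hbR j) (hupd (σ j) z) (hnorm _ z hz)
  · have hA : Tendsto (fun z => Acoef q σ (Function.update w k z)) (Bornology.cobounded ℂ)
        (𝓝 (∏ p ∈ Finset.univ.filter
          (fun p : Fin (n + 1) × Fin (n + 1) => p.2 < p.1 ∧ σ⁻¹ p.1 < σ⁻¹ p.2),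
            if p.1 = k then (q : ℂ) else -((q : ℂ) * w p.1 - w p.2) / ((q : ℂ) * w p.2 - w p.1))) := by
      refine tendsto_finsetProd _ fun p hp => ?_
      have h2 := hinv _ _ (Finset.mem_filter.1 hp).2.2
      simp only [Function.update_of_ne h2]
      split_ifs with h1
      · simpa [h1] using tendsto_scattering_cobounded q (w p.2)
      · simpa only [Function.update_of_ne h1] using tendsto_const_nhds
    have hE := tendsto_mul_eprod_cobounded (fun i => (b i : ℂ)) h
    have hT := (hA.mul hE).mul_const (∏ j : Fin n,
      eprod (fun i => (b i : ℂ) / ((b i : ℂ) - w (σ j.succ))) (Y (σ j.succ)) (X j.succ))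
    rw [mul_zero, zero_mul] at hT
    refine hT.congr fun z => ?_
    have hs : ∀ j : Fin n, σ j.succ ≠ k := fun j hj =>
      Fin.succ_ne_zero j (σ.injective (hj.trans hσ.symm))
    rw [Fin.prod_univ_succ]
    simp only [hσ, Function.update_self, Function.update_of_ne (hs _)]
    ring
end
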